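/- For every natural number n, the number of elevated large (3,2)-Motzkin paths of length n + 2 equals 2·m_n, where m_n is the number of (3,2)-Motzkin paths of length n. (Every elevated large (3,2)-Motzkin path of length n + 2 has the form U·P·D, where P is an arbitrary (3,2)-Motzkin path of length n and D ∈ {D₁, D₂}.) -/

import Mathlib

/-- Steps of a (3,2)-Motzkin path: one up step, two colored down steps,
three colored level steps. -/
inductive MStep : Type
  | U | D1 | D2 | L1 | L2 | L3
  deriving DecidableEq

/-- Height contribution of a single step. -/
def MStep.height : MStep → ℤ
  | .U  => 1
  | .D1 => -1
  | .D2 => -1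
  | .L1 => 0
  | .L2 => 0
  | .L3 => 0

/-- Total height of a list of steps. -/
def mHeight (p : List MStep) : ℤ := (p.map MStep.height).sum

/-- A (3,2)-Motzkin path: all prefixes have nonnegative height and the
total height is 0. -/
def IsMotzkin32 (p : List MStep) : Prop :=
  (∀ q : List MStep, q <+: p → 0 ≤ mHeight q) ∧ mHeight p = 0

/-- A large (3,2)-Motzkin path: a (3,2)-Motzkin path with no `L3` level step
on the x-axis, i.e. the prefix preceding any `L3` step has positive height. -/
def IsLargeMotzkin32 (p : List MStep) : Prop :=
  IsMotzkin32 p ∧ ∀ a b : List MStep, p = a ++ MStep.L3 :: b → 0 < mHeight a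

/-- `m32 n` is the number of (3,2)-Motzkin paths of length `n`. -/
noncomputable def m32 (n : ℕ) : ℕ :=
  {p : List MStep | p.length = n ∧ IsMotzkin32 p}.ncard

/-- `L32 n` is the number of large (3,2)-Motzkin paths of length `n`. -/
noncomputable def L32 (n : ℕ) : ℕ :=
  {p : List MStep | p.length = n ∧ IsLargeMotzkin32 p}.ncard

/-- An elevated large (3,2)-Motzkin path: a large (3,2)-Motzkin path that
touches the x-axis only at its endpoints. -/
def IsElevatedLargeMotzkin32 (p : List MStep) : Prop :=
  IsLargeMotzkin32 p ∧
    ∀ q : List MStep, q <+: p → q ≠ [] → q ≠ p → 0 < mHeight q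

/-- A linked partition of `{1,…,n}`: blocks are nonempty subsets of
`{1,…,n}` covering it, and any two distinct blocks are nearly disjoint. -/
def IsLinkedPartition (n : ℕ) (π : Finset (Finset ℕ)) : Prop :=
  (∀ B ∈ π, B.Nonempty ∧ B ⊆ Finset.Icc 1 n) ∧
  (∀ i ∈ Finset.Icc 1 n, ∃ B ∈ π, i ∈ B) ∧
  (∀ B ∈ π, ∀ B' ∈ π, B ≠ B' → ∀ k, k ∈ B → k ∈ B' →
    ((∀ j ∈ B, k ≤ j) ∧ 1 < B.card ∧ ¬ (∀ j ∈ B', k ≤ j)) ∨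
    ((∀ j ∈ B', k ≤ j) ∧ 1 < B'.card ∧ ¬ (∀ j ∈ B, k ≤ j)))

/-- Noncrossing condition for a collection of blocks. -/
def IsNoncrossing (π : Finset (Finset ℕ)) : Prop :=
  ¬ ∃ B ∈ π, ∃ B' ∈ π, B ≠ B' ∧
      ∃ i₁ ∈ B, ∃ j₁ ∈ B, ∃ i₂ ∈ B', ∃ j₂ ∈ B',
        i₁ < i₂ ∧ i₂ < j₁ ∧ j₁ < j₂

/-- `ncl n` is the number of noncrossing linked partitions of `{1,…,n}`. -/
noncomputable def ncl (n : ℕ) : ℕ :=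
  {π : Finset (Finset ℕ) | IsLinkedPartition n π ∧ IsNoncrossing π}.ncard

/-- Steps of a Schröder path: up, level (width 2), down. -/
inductive SStep : Type
  | U | L | D
  deriving DecidableEq

/-- Height contribution of a Schröder step. -/
def SStep.height : SStep → ℤ
  | .U => 1
  | .L => 0
  | .D => -1

/-- Width contribution of a Schröder step. -/
def SStep.width : SStep → ℕ
  | .U => 1
  | .L => 2
  | .D => 1

/-- Total height of a list of Schröder steps. -/
def sHeight (p : List SStep) : ℤ := (p.map SStep.height).sum

/-- Total width of a list of Schröder steps. -/
def sWidth (p : List SStep) : ℕ := (p.map SStep.width).sum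

/-- A large Schröder path of length `2n`. -/
def IsLargeSchroeder (n : ℕ) (p : List SStep) : Prop :=
  sWidth p = 2 * n ∧ (∀ q : List SStep, q <+: p → 0 ≤ sHeight q) ∧
    sHeight p = 0

/-- A little Schröder path of length `2n`: a large Schröder path with no
level step on the x-axis. -/
def IsLittleSchroeder (n : ℕ) (p : List SStep) : Prop :=
  IsLargeSchroeder n p ∧ ∀ a b : List SStep, p = a ++ SStep.L :: b → 0 < sHeight a

/-- `SchroederLarge n` is the `n`-th large Schröder number. -/
noncomputable def SchroederLarge (n : ℕ) : ℕ :=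
  {p : List SStep | IsLargeSchroeder n p}.ncard

/-- `SchroederLittle n` is the `n`-th little Schröder number. -/
noncomputable def SchroederLittle (n : ℕ) : ℕ :=
  {p : List SStep | IsLittleSchroeder n p}.ncard

theorem mHeight_nil' : mHeight [] = 0 := by simp [mHeight]

theorem mHeight_cons' (x : MStep) (p : List MStep) :
    mHeight (x :: p) = x.height + mHeight p := by simp [mHeight]

theorem mHeight_append' (p q : List MStep) :
    mHeight (p ++ q) = mHeight p + mHeight q := by simp [mHeight]

/-- Wrapping a Motzkin path as `U P D` gives an elevated large path. -/
theorem elevated_of_motzkin (P : List MStep) (d : MStep) (hd : d.height = -1)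
    (hP : IsMotzkin32 P) : IsElevatedLargeMotzkin32 (MStep.U :: (P ++ [d])) := by
  have hU : MStep.U.height = 1 := rfl
  have htot : mHeight (MStep.U :: (P ++ [d])) = 0 := by
    rw [mHeight_cons', mHeight_append', mHeight_cons', mHeight_nil', hP.2, hd, hU]
    norm_num
  have hel : ∀ q : List MStep, q <+: MStep.U :: (P ++ [d]) → q ≠ [] →
      q ≠ MStep.U :: (P ++ [d]) → 0 < mHeight q := by
    intro q hq hne hnp
    rcases List.prefix_cons_iff.1 hq with h | ⟨t, rfl, ht⟩
    · exact absurd h hne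
    · rcases List.prefix_concat_iff.1 ht with h | h
      · exact absurd (by rw [h]) hnp
      · have := hP.1 t h
        rw [mHeight_cons', hU]
        omega
  refine ⟨⟨⟨?_, htot⟩, ?_⟩, hel⟩
  · intro q hq
    by_cases h1 : q = []
    · rw [h1, mHeight_nil']
    by_cases h2 : q = MStep.U :: (P ++ [d])
    · rw [h2, htot]
    exact (hel q hq h1 h2).le
  · intro a b hab
    apply hel a ⟨_, hab.symm⟩
    · rintro rfl
      simp at hab
    · intro h
      have := congrArg List.length hab
      rw [h] at this
      simp at this

/-- Every elevated large path of length `n + 2` is `U P D` with `P` a Motzkin path. -/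
theorem motzkin_of_elevated (n : ℕ) (p : List MStep) (hl : p.length = n + 2)
    (hp : IsElevatedLargeMotzkin32 p) :
    ∃ P d, P.length = n ∧ IsMotzkin32 P ∧ (d = MStep.D1 ∨ d = MStep.D2) ∧
      p = MStep.U :: (P ++ [d]) := by
  obtain ⟨⟨⟨-, htot⟩, -⟩, hel⟩ := hp
  cases p with
  | nil => simp at hl
  | cons x r =>
    rcases List.eq_nil_or_concat r with rfl | ⟨P, d, rfl⟩
    · simp at hl
    rw [List.concat_eq_append] at *
    have hx : 0 < mHeight [x] := hel [x] (by simp) (by simp) (by simp)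
    rw [mHeight_cons', mHeight_nil'] at hx
    have hxU : x = MStep.U := by
      cases x <;> simp [MStep.height] at hx ⊢
    subst hxU
    have hU : MStep.U.height = 1 := rfl
    have hpre : ∀ q, q <+: P → 0 ≤ mHeight q := by
      intro q hq
      have := hel (MStep.U :: q)
        (by
          rw [List.cons_prefix_cons]
          exact ⟨rfl, hq.trans (List.prefix_append _ _)⟩)
        (by simp)
        (by
          intro h
          have h1 := congrArg List.length h
          have h2 := hq.length_le
          simp at h1
          omega)
      rw [mHeight_cons', hU] at this
      omega
    have hPn := hpre P (List.prefix_refl P)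
    rw [mHeight_cons', mHeight_append', mHeight_cons', mHeight_nil', hU] at htot
    have hd : d = MStep.D1 ∨ d = MStep.D2 := by
      cases d <;> simp [MStep.height] at htot ⊢ <;> omega
    have hdh : d.height = -1 := by rcases hd with rfl | rfl <;> rfl
    refine ⟨P, d, by simpa using hl, ⟨hpre, by omega⟩, hd, rfl⟩

theorem finite_length_mstep (n : ℕ) : {p : List MStep | p.length = n}.Finite := by
  have : Finite MStep := by
    apply Finite.of_surjective (fun i : Fin 6 =>
      ![MStep.U, MStep.D1, MStep.D2, MStep.L1, MStep.L2, MStep.L3] i)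
    intro x
    cases x
    · exact ⟨0, rfl⟩
    · exact ⟨1, rfl⟩
    · exact ⟨2, rfl⟩
    · exact ⟨3, rfl⟩
    · exact ⟨4, rfl⟩
    · exact ⟨5, rfl⟩
  exact List.finite_length_eq MStep n

/-- The number of elevated large (3,2)-Motzkin paths of length `n + 2`
equals twice the number of (3,2)-Motzkin paths of length `n`. -/
theorem elevated_large_motzkin32_eq_two_mul_motzkin32 (n : ℕ) :
    {p : List MStep | p.length = n + 2 ∧ IsElevatedLargeMotzkin32 p}.ncard =
      2 * m32 n := by
  have hfin : {p : List MStep | p.length = n ∧ IsMotzkin32 p}.Finite :=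
    (finite_length_mstep n).subset fun p hp => hp.1
  have hinj : ∀ d : MStep,
      Function.Injective (fun P : List MStep => MStep.U :: (P ++ [d])) := by
    intro d P Q h
    simpa using h
  have hset : {p : List MStep | p.length = n + 2 ∧ IsElevatedLargeMotzkin32 p} =
      (fun P : List MStep => MStep.U :: (P ++ [MStep.D1])) ''
        {p : List MStep | p.length = n ∧ IsMotzkin32 p} ∪
      (fun P : List MStep => MStep.U :: (P ++ [MStep.D2])) ''
        {p : List MStep | p.length = n ∧ IsMotzkin32 p} := by
    ext p
    constructor
    · rintro ⟨hl, hp⟩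
      obtain ⟨P, d, hPl, hP, hd, rfl⟩ := motzkin_of_elevated n p hl hp
      rcases hd with rfl | rfl
      · exact Or.inl ⟨P, ⟨hPl, hP⟩, rfl⟩
      · exact Or.inr ⟨P, ⟨hPl, hP⟩, rfl⟩
    · rintro (⟨P, ⟨hPl, hP⟩, rfl⟩ | ⟨P, ⟨hPl, hP⟩, rfl⟩)
      · exact ⟨by simp [hPl], elevated_of_motzkin P _ rfl hP⟩
      · exact ⟨by simp [hPl], elevated_of_motzkin P _ rfl hP⟩
  rw [hset, Set.ncard_union_eq ?_ (hfin.image _) (hfin.image _),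
    Set.ncard_image_of_injective _ (hinj _), Set.ncard_image_of_injective _ (hinj _), m32, two_mul]
  rw [Set.disjoint_left]
  rintro _ ⟨P, -, rfl⟩ ⟨Q, -, h⟩
  have h2 := (List.cons.inj h).2
  have h3 := (List.append_inj' h2 rfl).2
  simp at h3
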